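/- Let μ be an orthogonally invariant probability measure on ℝⁿ and let W, W̃, X : Ω → ℝⁿ be mutually independent random vectors with W and W̃ both of law μ. Define the lower-tail dependence measure Δ̃(z₁, z₂) := P(⟨W, X⟩ ≤ z₁, ⟨W̃, X⟩ ≤ z₂) − P(⟨W, X⟩ ≤ z₁) · P(⟨W̃, X⟩ ≤ z₂). Then Δ̃(z₁, z₂) ≥ 0 whenever z₁ · z₂ > 0, and Δ̃(z₁, z₂) ≤ 0 whenever z₁ · z₂ < 0. (Lower-tail analogue of the hidden units dependence theorem, obtained by symmetry of the centered weight prior.) -/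

import Mathlib

open MeasureTheory ProbabilityTheory
open scoped RealInnerProductSpace

/-- Chebyshev's correlation inequality for functions that vary in the same direction. -/
lemma lintegral_mul_lintegral_le_lintegral_mul {α : Type*} [MeasurableSpace α] (ν : Measure α)
    [IsProbabilityMeasure ν] {f g : α → ENNReal} (hf : Measurable f) (hg : Measurable g)
    (h : ∀ x y, f x * g y + f y * g x ≤ f x * g x + f y * g y) :
    (∫⁻ x, f x ∂ν) * ∫⁻ x, g x ∂ν ≤ ∫⁻ x, f x * g x ∂ν := by
  have key : ∫⁻ x, ∫⁻ y, (f x * g y + f y * g x) ∂ν ∂ν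
      ≤ ∫⁻ x, ∫⁻ y, (f x * g x + f y * g y) ∂ν ∂ν :=
    lintegral_mono fun x => lintegral_mono fun y => h x y
  simp_rw [lintegral_add_left (hg.const_mul _), lintegral_add_left measurable_const,
    lintegral_const_mul _ hg, lintegral_mul_const _ hf, lintegral_const, measure_univ,
    mul_one] at key
  rw [lintegral_add_left (hf.mul_const _), lintegral_add_right _ measurable_const,
    lintegral_mul_const _ hf, lintegral_const_mul _ hg, lintegral_const, measure_univ,
    mul_one, ← two_mul, ← two_mul] at key
  exact (ENNReal.mul_le_mul_iff_right (by simp) (by simp)).1 key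

/-- Chebyshev's correlation inequality for functions that vary in opposite directions. -/
lemma lintegral_mul_le_lintegral_mul_lintegral {α : Type*} [MeasurableSpace α] (ν : Measure α)
    [IsProbabilityMeasure ν] {f g : α → ENNReal} (hf : Measurable f) (hg : Measurable g)
    (h : ∀ x y, f x * g x + f y * g y ≤ f x * g y + f y * g x) :
    ∫⁻ x, f x * g x ∂ν ≤ (∫⁻ x, f x ∂ν) * ∫⁻ x, g x ∂ν := by
  have key : ∫⁻ x, ∫⁻ y, (f x * g x + f y * g y) ∂ν ∂ν
      ≤ ∫⁻ x, ∫⁻ y, (f x * g y + f y * g x) ∂ν ∂ν :=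
    lintegral_mono fun x => lintegral_mono fun y => h x y
  simp_rw [lintegral_add_left (hg.const_mul _), lintegral_add_left measurable_const,
    lintegral_const_mul _ hg, lintegral_mul_const _ hf, lintegral_const, measure_univ,
    mul_one] at key
  rw [lintegral_add_left (hf.mul_const _), lintegral_add_right _ measurable_const,
    lintegral_mul_const _ hf, lintegral_const_mul _ hg, lintegral_const, measure_univ,
    mul_one, ← two_mul, ← two_mul] at key
  exact (ENNReal.mul_le_mul_iff_right (by simp) (by simp)).1 key

/-- The rearrangement inequality for two pairs of extended nonnegative reals. -/
lemma ENNReal.mul_add_mul_le_of_le {a b c d : ENNReal} (hab : a ≤ b) (hcd : c ≤ d) :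
    a * d + b * c ≤ a * c + b * d := by
  obtain ⟨e, rfl⟩ := exists_add_of_le hab
  calc a * d + (a + e) * c = a * c + (a * d + e * c) := by ring
    _ ≤ a * c + (a * d + e * d) := by gcongr
    _ = a * c + (a + e) * d := by ring

section Spherical

variable {E : Type*} [NormedAddCommGroup E] [InnerProductSpace ℝ E]

/-- Vectors of the same norm are related by a linear isometry. -/
lemma exists_linearIsometryEquiv_apply_eq {v w : E} (h : ‖v‖ = ‖w‖) :
    ∃ Q : E ≃ₗᵢ[ℝ] E, Q v = w :=
  ⟨(ℝ ∙ (v - w))ᗮ.reflection, Submodule.reflection_sub h⟩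

/-- A vector of smaller norm is a contraction followed by an isometry applied to the larger one. -/
lemma exists_linearIsometryEquiv_smul_eq {x y : E} (h : ‖x‖ ≤ ‖y‖) :
    ∃ (c : ℝ) (Q : E ≃ₗᵢ[ℝ] E), 0 ≤ c ∧ c ≤ 1 ∧ Q (c • y) = x := by
  have hc : ‖(‖x‖ / ‖y‖) • y‖ = ‖x‖ := by
    rcases eq_or_ne ‖y‖ 0 with hy | hy
    · have : ‖x‖ = 0 := le_antisymm (hy ▸ h) (norm_nonneg x)
      simp [this]
    · rw [norm_smul, Real.norm_of_nonneg (by positivity), div_mul_cancel₀ _ hy]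
  obtain ⟨Q, hQ⟩ := exists_linearIsometryEquiv_apply_eq hc
  exact ⟨_, Q, by positivity, div_le_one_of_le₀ h (norm_nonneg y), hQ⟩

variable [MeasurableSpace E] [BorelSpace E] {μ : Measure E}

lemma measure_inner_le_linearIsometryEquiv
    (hinv : ∀ Q : E ≃ₗᵢ[ℝ] E, Measure.map Q μ = μ) (Q : E ≃ₗᵢ[ℝ] E) (x : E) (z : ℝ) :
    μ {w | ⟪w, Q x⟫ ≤ z} = μ {w | ⟪w, x⟫ ≤ z} := by
  have hS : MeasurableSet {w : E | ⟪w, Q x⟫ ≤ z} :=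
    (isClosed_le (by fun_prop) continuous_const).measurableSet
  conv_lhs => rw [← hinv Q, Measure.map_apply Q.continuous.measurable hS]
  simp

/-- At a nonnegative threshold, the lower tail of a spherical measure decreases with the norm. -/
lemma measure_inner_le_anti_norm
    (hinv : ∀ Q : E ≃ₗᵢ[ℝ] E, Measure.map Q μ = μ) {z : ℝ} (hz : 0 ≤ z) {x y : E}
    (h : ‖x‖ ≤ ‖y‖) : μ {w | ⟪w, y⟫ ≤ z} ≤ μ {w | ⟪w, x⟫ ≤ z} := by
  obtain ⟨c, Q, hc0, hc1, rfl⟩ := exists_linearIsometryEquiv_smul_eq h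
  rw [measure_inner_le_linearIsometryEquiv hinv]
  refine measure_mono fun w hw => ?_
  simp only [Set.mem_ofPred_eq, real_inner_smul_right] at hw ⊢
  nlinarith

/-- At a negative threshold, the lower tail of a spherical measure increases with the norm. -/
lemma measure_inner_le_mono_norm
    (hinv : ∀ Q : E ≃ₗᵢ[ℝ] E, Measure.map Q μ = μ) {z : ℝ} (hz : z < 0) {x y : E}
    (h : ‖x‖ ≤ ‖y‖) : μ {w | ⟪w, x⟫ ≤ z} ≤ μ {w | ⟪w, y⟫ ≤ z} := by
  obtain ⟨c, Q, hc0, hc1, rfl⟩ := exists_linearIsometryEquiv_smul_eq h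
  rw [measure_inner_le_linearIsometryEquiv hinv]
  refine measure_mono fun w hw => ?_
  simp only [Set.mem_ofPred_eq, real_inner_smul_right] at hw ⊢
  rcases le_total ⟪w, y⟫ 0 with hwy | hwy
  · nlinarith
  · nlinarith [mul_nonneg hc0 hwy]

variable [SecondCountableTopology E]

lemma measurableSet_inner_le (z : ℝ) : MeasurableSet {p : E × E | ⟪p.1, p.2⟫ ≤ z} :=
  measurableSet_le (measurable_fst.inner measurable_snd) measurable_const

lemma measurable_measure_inner_le [SFinite μ] (z : ℝ) :
    Measurable fun x : E => μ {w | ⟪w, x⟫ ≤ z} :=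
  measurable_measure_prodMk_right (measurableSet_inner_le z)

variable {Ω : Type*} [MeasurableSpace Ω] {P : Measure Ω} [IsProbabilityMeasure P]
  {W W' X : Ω → E}

/-- The lower tail of the inner product of independent vectors, by conditioning on one of them. -/
lemma measure_inner_le_eq_lintegral [IsProbabilityMeasure μ]
    (hW : Measurable W) (hX : Measurable X)
    (hindep : IndepFun W X P) (hWlaw : Measure.map W P = μ) (z : ℝ) :
    P {ω | ⟪W ω, X ω⟫ ≤ z} = ∫⁻ x, μ {w | ⟪w, x⟫ ≤ z} ∂(Measure.map X P) := by
  have : IsProbabilityMeasure (Measure.map X P) := Measure.isProbabilityMeasure_map hX.aemeasurable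
  have hmap := (indepFun_iff_map_prod_eq_prod_map_map hW.aemeasurable hX.aemeasurable).1 hindep
  rw [hWlaw] at hmap
  have hS := measurableSet_inner_le (E := E) z
  calc P {ω | ⟪W ω, X ω⟫ ≤ z}
      = Measure.map (fun ω => (W ω, X ω)) P {p : E × E | ⟪p.1, p.2⟫ ≤ z} :=
        (Measure.map_apply (hW.prodMk hX) hS).symm
    _ = _ := by rw [hmap, Measure.prod_apply_symm hS]; rfl

/-- The joint lower tail of two inner products with a common independent factor, by conditioning
on that factor. -/
lemma measure_inner_le_and_inner_le_eq_lintegral [IsProbabilityMeasure μ]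
    (hW : Measurable W) (hW' : Measurable W') (hX : Measurable X)
    (hindep : IndepFun W W' P) (hindepX : IndepFun (fun ω => (W ω, W' ω)) X P)
    (hWlaw : Measure.map W P = μ) (hW'law : Measure.map W' P = μ) (z₁ z₂ : ℝ) :
    P {ω | ⟪W ω, X ω⟫ ≤ z₁ ∧ ⟪W' ω, X ω⟫ ≤ z₂} =
      ∫⁻ x, μ {w | ⟪w, x⟫ ≤ z₁} * μ {w | ⟪w, x⟫ ≤ z₂} ∂(Measure.map X P) := by
  have : IsProbabilityMeasure (Measure.map X P) := Measure.isProbabilityMeasure_map hX.aemeasurable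
  have hmap := (indepFun_iff_map_prod_eq_prod_map_map hW.aemeasurable hW'.aemeasurable).1 hindep
  have hmapX := (indepFun_iff_map_prod_eq_prod_map_map (hW.prodMk hW').aemeasurable
    hX.aemeasurable).1 hindepX
  rw [hWlaw, hW'law] at hmap
  rw [hmap] at hmapX
  have hS : MeasurableSet {p : (E × E) × E | ⟪p.1.1, p.2⟫ ≤ z₁ ∧ ⟪p.1.2, p.2⟫ ≤ z₂} :=
    MeasurableSet.inter (s₁ := {p : (E × E) × E | ⟪p.1.1, p.2⟫ ≤ z₁})
      (s₂ := {p : (E × E) × E | ⟪p.1.2, p.2⟫ ≤ z₂})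
      (measurableSet_le (measurable_fst.fst.inner measurable_snd) measurable_const)
      (measurableSet_le (measurable_fst.snd.inner measurable_snd) measurable_const)
  calc P {ω | ⟪W ω, X ω⟫ ≤ z₁ ∧ ⟪W' ω, X ω⟫ ≤ z₂}
      = Measure.map (fun ω => ((W ω, W' ω), X ω)) P
          {p : (E × E) × E | ⟪p.1.1, p.2⟫ ≤ z₁ ∧ ⟪p.1.2, p.2⟫ ≤ z₂} :=
        (Measure.map_apply ((hW.prodMk hW').prodMk hX) hS).symm
    _ = _ := by
        rw [hmapX, Measure.prod_apply_symm hS]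
        exact lintegral_congr fun x => Measure.prod_prod {w | ⟪w, x⟫ ≤ z₁} {w | ⟪w, x⟫ ≤ z₂}

end Spherical

/-- Lower-tail analogue of the hidden units dependence theorem: for an orthogonally
invariant weight prior `μ` and mutually independent `W, W̃, X` with `W, W̃` of law `μ`, the
lower-tail dependence measure
`Δ̃(z₁, z₂) = P(⟨W, X⟩ ≤ z₁, ⟨W̃, X⟩ ≤ z₂) − P(⟨W, X⟩ ≤ z₁) P(⟨W̃, X⟩ ≤ z₂)` satisfies
`Δ̃(z₁, z₂) ≥ 0` when `z₁ z₂ > 0` and `Δ̃(z₁, z₂) ≤ 0` when `z₁ z₂ < 0`. -/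
theorem hidden_units_lower_tail_dependence
    {Ω : Type*} [MeasureSpace Ω] [IsProbabilityMeasure (ℙ : Measure Ω)]
    {n : ℕ} (μ : Measure (EuclideanSpace ℝ (Fin n))) [IsProbabilityMeasure μ]
    (hinv : ∀ Q : EuclideanSpace ℝ (Fin n) ≃ₗᵢ[ℝ] EuclideanSpace ℝ (Fin n),
      Measure.map Q μ = μ)
    (W W' X : Ω → EuclideanSpace ℝ (Fin n))
    (hWmeas : Measurable W) (hW'meas : Measurable W') (hXmeas : Measurable X)
    (hindep : IndepFun W W' ℙ)
    (hindepX : IndepFun (fun ω => (W ω, W' ω)) X ℙ)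
    (hWlaw : Measure.map W ℙ = μ) (hW'law : Measure.map W' ℙ = μ)
    (z₁ z₂ : ℝ) :
    (0 < z₁ * z₂ →
        ℙ {ω | ⟪W ω, X ω⟫ ≤ z₁} * ℙ {ω | ⟪W' ω, X ω⟫ ≤ z₂} ≤
          ℙ {ω | ⟪W ω, X ω⟫ ≤ z₁ ∧ ⟪W' ω, X ω⟫ ≤ z₂}) ∧
      (z₁ * z₂ < 0 →
        ℙ {ω | ⟪W ω, X ω⟫ ≤ z₁ ∧ ⟪W' ω, X ω⟫ ≤ z₂} ≤
          ℙ {ω | ⟪W ω, X ω⟫ ≤ z₁} * ℙ {ω | ⟪W' ω, X ω⟫ ≤ z₂}) := by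
  have : IsProbabilityMeasure (Measure.map X ℙ) :=
    Measure.isProbabilityMeasure_map hXmeas.aemeasurable
  have hm (z : ℝ) := measurable_measure_inner_le (μ := μ) z
  rw [measure_inner_le_and_inner_le_eq_lintegral hWmeas hW'meas hXmeas hindep hindepX hWlaw hW'law,
    measure_inner_le_eq_lintegral hWmeas hXmeas (hindepX.comp measurable_fst measurable_id) hWlaw,
    measure_inner_le_eq_lintegral hW'meas hXmeas (hindepX.comp measurable_snd measurable_id)
      hW'law]
  constructor
  · intro hz
    refine lintegral_mul_lintegral_le_lintegral_mul _ (hm z₁) (hm z₂) fun x y => ?_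
    wlog hxy : ‖x‖ ≤ ‖y‖ generalizing x y
    · simpa only [add_comm] using this y x (le_of_not_ge hxy)
    rcases mul_pos_iff.1 hz with ⟨h₁, h₂⟩ | ⟨h₁, h₂⟩
    · have := ENNReal.mul_add_mul_le_of_le (measure_inner_le_anti_norm hinv h₁.le hxy)
        (measure_inner_le_anti_norm hinv h₂.le hxy)
      simpa only [add_comm] using this
    · exact ENNReal.mul_add_mul_le_of_le (measure_inner_le_mono_norm hinv h₁ hxy)
        (measure_inner_le_mono_norm hinv h₂ hxy)
  · intro hz
    refine lintegral_mul_le_lintegral_mul_lintegral _ (hm z₁) (hm z₂) fun x y => ?_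
    wlog hxy : ‖x‖ ≤ ‖y‖ generalizing x y
    · simpa only [add_comm] using this y x (le_of_not_ge hxy)
    rcases mul_neg_iff.1 hz with ⟨h₁, h₂⟩ | ⟨h₁, h₂⟩
    · have := ENNReal.mul_add_mul_le_of_le (measure_inner_le_anti_norm hinv h₁.le hxy)
        (measure_inner_le_mono_norm hinv h₂ hxy)
      simpa only [add_comm] using this
    · exact ENNReal.mul_add_mul_le_of_le (measure_inner_le_mono_norm hinv h₁ hxy)
        (measure_inner_le_anti_norm hinv h₂.le hxy)
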